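/- Let (f,g,h) be a good map of triangles from a distinguished triangle X →u Y →v Z →w ΣX to a distinguished triangle X' →u' Y' →v' Z' →w' ΣX', so that its mapping cone is a distinguished triangle. Then: (1) the triple of canonical direct-summand inclusions (X'→X'⊕Y, Y'→Y'⊕Z, Z'→Z'⊕ΣX) is a good map of triangles from the triangle (u',v',w') to the mapping cone; (2) the triple of canonical direct-summand projections (X'⊕Y→Y, Y'⊕Z→Z, Z'⊕ΣX→ΣX) is a good map of triangles from the mapping cone to the distinguished triangle Y →−v Z →−w ΣX →−Σu ΣY. -/

import Mathlib

open CategoryTheory Category Limits Pretriangulated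

universe v u

variable {C : Type u} [Category.{v} C] [Preadditive C] [HasZeroObject C]
  [HasShift C ℤ] [∀ n : ℤ, (shiftFunctor C n).Additive] [Pretriangulated C]
  [IsTriangulated C] [HasBinaryBiproducts C]

noncomputable local instance (n : ℤ) : PreservesBinaryBiproducts (shiftFunctor C n) :=
  preservesBinaryBiproducts_of_preservesBiproducts _

/-- The condition that `(f, g, h)` is a morphism of triangles from `T` to `T'`. -/
def IsTriMap (T T' : Triangle C) (f : T.obj₁ ⟶ T'.obj₁) (g : T.obj₂ ⟶ T'.obj₂)
    (h : T.obj₃ ⟶ T'.obj₃) : Prop :=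
  T.mor₁ ≫ g = f ≫ T'.mor₁ ∧ T.mor₂ ≫ h = g ≫ T'.mor₂ ∧
    T.mor₃ ≫ f⟦(1 : ℤ)⟧' = h ≫ T'.mor₃

/-- The mapping cone of a morphism of triangles. -/
noncomputable def mappingCone (T T' : Triangle C) (f : T.obj₁ ⟶ T'.obj₁)
    (g : T.obj₂ ⟶ T'.obj₂) (h : T.obj₃ ⟶ T'.obj₃) : Triangle C :=
  Triangle.mk
    (biprod.desc (biprod.lift T'.mor₁ 0) (biprod.lift g (-T.mor₂)) :
      T'.obj₁ ⊞ T.obj₂ ⟶ T'.obj₂ ⊞ T.obj₃)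
    (biprod.desc (biprod.lift T'.mor₂ 0) (biprod.lift h (-T.mor₃)) :
      T'.obj₂ ⊞ T.obj₃ ⟶ T'.obj₃ ⊞ T.obj₁⟦(1 : ℤ)⟧)
    (biprod.desc (biprod.lift T'.mor₃ 0)
        (biprod.lift (f⟦(1 : ℤ)⟧') (-(T.mor₁⟦(1 : ℤ)⟧'))) ≫
      ((shiftFunctor C (1 : ℤ)).mapBiprod T'.obj₁ T.obj₂).inv)

/-- A morphism of triangles is good if its mapping cone is distinguished. -/
noncomputable def IsGood (T T' : Triangle C) (f : T.obj₁ ⟶ T'.obj₁)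
    (g : T.obj₂ ⟶ T'.obj₂) (h : T.obj₃ ⟶ T'.obj₃) : Prop :=
  mappingCone T T' f g h ∈ distTriang C

/-- An octahedron on composable maps `a`, `b`, given distinguished triangles
`(a, p₁, q₁)`, `(b, p₂, q₂)` and `(a ≫ b, p₃, q₃)`, is a pair `(m, n)` as below. -/
def IsOctahedron {A₁ A₂ A₃ B₁ B₂ B₃ : C} (a : A₁ ⟶ A₂) (b : A₂ ⟶ A₃)
    (p₁ : A₂ ⟶ B₁) (q₁ : B₁ ⟶ A₁⟦(1 : ℤ)⟧)
    (p₂ : A₃ ⟶ B₂) (q₂ : B₂ ⟶ A₂⟦(1 : ℤ)⟧)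
    (p₃ : A₃ ⟶ B₃) (q₃ : B₃ ⟶ A₁⟦(1 : ℤ)⟧)
    (m : B₁ ⟶ B₃) (n : B₃ ⟶ B₂) : Prop :=
  p₁ ≫ m = b ≫ p₃ ∧ m ≫ q₃ = q₁ ∧ p₃ ≫ n = p₂ ∧ n ≫ q₂ = q₃ ≫ a⟦(1 : ℤ)⟧' ∧
    (Triangle.mk m n (q₂ ≫ p₁⟦(1 : ℤ)⟧') ∈ distTriang C)

/-- A morphism of triangles `(f, g, h)` is Verdier good if `h` arises from Verdier's
construction via two octahedra on the composite `g ∘ u = u' ∘ f`. -/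
def IsVerdierGood (T T' : Triangle C) (f : T.obj₁ ⟶ T'.obj₁) (g : T.obj₂ ⟶ T'.obj₂)
    (h : T.obj₃ ⟶ T'.obj₃) : Prop :=
  ∃ (A Y'' X'' : C) (vt : T'.obj₂ ⟶ A) (wt : A ⟶ T.obj₁⟦(1 : ℤ)⟧)
    (g' : T'.obj₂ ⟶ Y'') (g'' : Y'' ⟶ T.obj₂⟦(1 : ℤ)⟧)
    (f' : T'.obj₁ ⟶ X'') (f'' : X'' ⟶ T.obj₁⟦(1 : ℤ)⟧)
    (α₁ : T.obj₃ ⟶ A) (β₁ : A ⟶ Y'') (α₂ : X'' ⟶ A) (β₂ : A ⟶ T'.obj₃),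
    (Triangle.mk (T.mor₁ ≫ g) vt wt ∈ distTriang C) ∧
    (Triangle.mk g g' g'' ∈ distTriang C) ∧
    (Triangle.mk f f' f'' ∈ distTriang C) ∧
    IsOctahedron T.mor₁ g T.mor₂ T.mor₃ g' g'' vt wt α₁ β₁ ∧
    IsOctahedron f T'.mor₁ f' f'' T'.mor₂ T'.mor₃ vt wt α₂ β₂ ∧
    h = α₁ ≫ β₂

/-- The morphism of triangles `(f, g, h)` is nullhomotopic, in the (equivalent)
`Σ`-applied formulation of the first equation. -/
def IsNullHomotopic (T T' : Triangle C) (f : T.obj₁ ⟶ T'.obj₁) (g : T.obj₂ ⟶ T'.obj₂)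
    (h : T.obj₃ ⟶ T'.obj₃) : Prop :=
  ∃ (F : T.obj₂ ⟶ T'.obj₁) (G : T.obj₃ ⟶ T'.obj₂) (H : T.obj₁⟦(1 : ℤ)⟧ ⟶ T'.obj₃),
    f⟦(1 : ℤ)⟧' = T.mor₁⟦(1 : ℤ)⟧' ≫ F⟦(1 : ℤ)⟧' + H ≫ T'.mor₃ ∧
    g = T.mor₂ ≫ G + F ≫ T'.mor₁ ∧
    h = T.mor₃ ≫ H + G ≫ T'.mor₂

/-- A triangle is contractible if its identity morphism is nullhomotopic. -/
def IsContractible (T : Triangle C) : Prop :=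
  IsNullHomotopic T T (𝟙 T.obj₁) (𝟙 T.obj₂) (𝟙 T.obj₃)

/-- A morphism of triangles is middling good if it extends to a 4 × 4 diagram. -/
def IsMiddlingGood (T T' : Triangle C) (f : T.obj₁ ⟶ T'.obj₁) (g : T.obj₂ ⟶ T'.obj₂)
    (h : T.obj₃ ⟶ T'.obj₃) : Prop :=
  ∃ (X'' Y'' Z'' : C)
    (f' : T'.obj₁ ⟶ X'') (f'' : X'' ⟶ T.obj₁⟦(1 : ℤ)⟧)
    (g' : T'.obj₂ ⟶ Y'') (g'' : Y'' ⟶ T.obj₂⟦(1 : ℤ)⟧)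
    (h' : T'.obj₃ ⟶ Z'') (h'' : Z'' ⟶ T.obj₃⟦(1 : ℤ)⟧)
    (u'' : X'' ⟶ Y'') (v'' : Y'' ⟶ Z'') (w'' : Z'' ⟶ X''⟦(1 : ℤ)⟧),
    (Triangle.mk f f' f'' ∈ distTriang C) ∧
    (Triangle.mk g g' g'' ∈ distTriang C) ∧
    (Triangle.mk h h' h'' ∈ distTriang C) ∧
    (Triangle.mk u'' v'' w'' ∈ distTriang C) ∧
    T'.mor₁ ≫ g' = f' ≫ u'' ∧
    T'.mor₂ ≫ h' = g' ≫ v'' ∧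
    T'.mor₃ ≫ f'⟦(1 : ℤ)⟧' = h' ≫ w'' ∧
    u'' ≫ g'' = f'' ≫ T.mor₁⟦(1 : ℤ)⟧' ∧
    v'' ≫ h'' = g'' ≫ T.mor₂⟦(1 : ℤ)⟧' ∧
    h'' ≫ T.mor₃⟦(1 : ℤ)⟧' = -(w'' ≫ f''⟦(1 : ℤ)⟧')

/-- A candidate triangle `(a, b, c)` is replaceably exact if each of its three maps
can be replaced to give a distinguished triangle. -/
def ReplaceablyExact {A B D : C} (a : A ⟶ B) (b : B ⟶ D) (c : D ⟶ A⟦(1 : ℤ)⟧) : Prop :=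
  (∃ a' : A ⟶ B, Triangle.mk a' b c ∈ distTriang C) ∧
  (∃ b' : B ⟶ D, Triangle.mk a b' c ∈ distTriang C) ∧
  (∃ c' : D ⟶ A⟦(1 : ℤ)⟧, Triangle.mk a b c' ∈ distTriang C)

set_option linter.unusedSectionVars false

lemma inl_mapBiprod_inv (A B : C) :
    biprod.inl ≫ ((shiftFunctor C (1 : ℤ)).mapBiprod A B).inv =
      (biprod.inl : A ⟶ A ⊞ B)⟦(1 : ℤ)⟧' := by
  rw [Functor.mapBiprod_inv]
  exact biprod.inl_desc _ _

lemma inr_mapBiprod_inv (A B : C) :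
    biprod.inr ≫ ((shiftFunctor C (1 : ℤ)).mapBiprod A B).inv =
      (biprod.inr : B ⟶ A ⊞ B)⟦(1 : ℤ)⟧' := by
  rw [Functor.mapBiprod_inv]
  exact biprod.inr_desc _ _

lemma shift_inl_fst (A B : C) :
    (biprod.inl : A ⟶ A ⊞ B)⟦(1 : ℤ)⟧' ≫ (biprod.fst : A ⊞ B ⟶ A)⟦(1 : ℤ)⟧' = 𝟙 _ := by
  simp [← Functor.map_comp]

lemma shift_inl_snd (A B : C) :
    (biprod.inl : A ⟶ A ⊞ B)⟦(1 : ℤ)⟧' ≫ (biprod.snd : A ⊞ B ⟶ B)⟦(1 : ℤ)⟧' = 0 := by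
  simp [← Functor.map_comp]

lemma shift_inr_fst (A B : C) :
    (biprod.inr : B ⟶ A ⊞ B)⟦(1 : ℤ)⟧' ≫ (biprod.fst : A ⊞ B ⟶ A)⟦(1 : ℤ)⟧' = 0 := by
  simp [← Functor.map_comp]

lemma shift_inr_snd (A B : C) :
    (biprod.inr : B ⟶ A ⊞ B)⟦(1 : ℤ)⟧' ≫ (biprod.snd : A ⊞ B ⟶ B)⟦(1 : ℤ)⟧' = 𝟙 _ := by
  simp [← Functor.map_comp]

lemma shift_inl_fst_assoc (A B : C) {K : C} (k : A⟦(1 : ℤ)⟧ ⟶ K) :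
    (biprod.inl : A ⟶ A ⊞ B)⟦(1 : ℤ)⟧' ≫ (biprod.fst : A ⊞ B ⟶ A)⟦(1 : ℤ)⟧' ≫ k = k := by
  rw [← assoc, shift_inl_fst, id_comp]

lemma shift_inl_snd_assoc (A B : C) {K : C} (k : B⟦(1 : ℤ)⟧ ⟶ K) :
    (biprod.inl : A ⟶ A ⊞ B)⟦(1 : ℤ)⟧' ≫ (biprod.snd : A ⊞ B ⟶ B)⟦(1 : ℤ)⟧' ≫ k = 0 := by
  rw [← assoc, shift_inl_snd, zero_comp]

lemma shift_inr_fst_assoc (A B : C) {K : C} (k : A⟦(1 : ℤ)⟧ ⟶ K) :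
    (biprod.inr : B ⟶ A ⊞ B)⟦(1 : ℤ)⟧' ≫ (biprod.fst : A ⊞ B ⟶ A)⟦(1 : ℤ)⟧' ≫ k = 0 := by
  rw [← assoc, shift_inr_fst, zero_comp]

lemma shift_inr_snd_assoc (A B : C) {K : C} (k : B⟦(1 : ℤ)⟧ ⟶ K) :
    (biprod.inr : B ⟶ A ⊞ B)⟦(1 : ℤ)⟧' ≫ (biprod.snd : A ⊞ B ⟶ B)⟦(1 : ℤ)⟧' ≫ k = k := by
  rw [← assoc, shift_inr_snd, id_comp]

lemma shift_inl_desc {A B K : C} (a : A ⟶ K) (b : B ⟶ K) :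
    (biprod.inl : A ⟶ A ⊞ B)⟦(1 : ℤ)⟧' ≫ (biprod.desc a b)⟦(1 : ℤ)⟧' = a⟦(1 : ℤ)⟧' := by
  rw [← Functor.map_comp, biprod.inl_desc]

lemma shift_inr_desc {A B K : C} (a : A ⟶ K) (b : B ⟶ K) :
    (biprod.inr : B ⟶ A ⊞ B)⟦(1 : ℤ)⟧' ≫ (biprod.desc a b)⟦(1 : ℤ)⟧' = b⟦(1 : ℤ)⟧' := by
  rw [← Functor.map_comp, biprod.inr_desc]

lemma shift_inl_desc_assoc {A B K L : C} (a : A ⟶ K) (b : B ⟶ K) (k : K⟦(1 : ℤ)⟧ ⟶ L) :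
    (biprod.inl : A ⟶ A ⊞ B)⟦(1 : ℤ)⟧' ≫ (biprod.desc a b)⟦(1 : ℤ)⟧' ≫ k = a⟦(1 : ℤ)⟧' ≫ k := by
  rw [← assoc, shift_inl_desc]

lemma shift_inr_desc_assoc {A B K L : C} (a : A ⟶ K) (b : B ⟶ K) (k : K⟦(1 : ℤ)⟧ ⟶ L) :
    (biprod.inr : B ⟶ A ⊞ B)⟦(1 : ℤ)⟧' ≫ (biprod.desc a b)⟦(1 : ℤ)⟧' ≫ k = b⟦(1 : ℤ)⟧' ≫ k := by
  rw [← assoc, shift_inr_desc]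

lemma shift_biprod_hom_ext {A B K : C} {a b : (A ⊞ B)⟦(1 : ℤ)⟧ ⟶ K}
    (h₁ : (biprod.inl : A ⟶ A ⊞ B)⟦(1 : ℤ)⟧' ≫ a = (biprod.inl : A ⟶ A ⊞ B)⟦(1 : ℤ)⟧' ≫ b)
    (h₂ : (biprod.inr : B ⟶ A ⊞ B)⟦(1 : ℤ)⟧' ≫ a = (biprod.inr : B ⟶ A ⊞ B)⟦(1 : ℤ)⟧' ≫ b) :
    a = b := by
  rw [← cancel_epi ((shiftFunctor C (1 : ℤ)).mapBiprod A B).inv]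
  apply biprod.hom_ext'
  · rw [← assoc, ← assoc, inl_mapBiprod_inv, h₁]
  · rw [← assoc, ← assoc, inr_mapBiprod_inv, h₂]

/-- The mapping cone of a morphism of triangles given by explicit morphisms, with entries
written without the identification of `(X' ⊞ Y)⟦1⟧` with `X'⟦1⟧ ⊞ Y⟦1⟧`. -/
noncomputable abbrev coneTriangle {X Y Z X' Y' Z' : C}
    (u : X ⟶ Y) (v : Y ⟶ Z) (w : Z ⟶ X⟦(1 : ℤ)⟧)
    (u' : X' ⟶ Y') (v' : Y' ⟶ Z') (w' : Z' ⟶ X'⟦(1 : ℤ)⟧)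
    (f : X ⟶ X') (g : Y ⟶ Y') (h : Z ⟶ Z') : Triangle C :=
  Triangle.mk
    (biprod.desc (u' ≫ biprod.inl) (g ≫ biprod.inl - v ≫ biprod.inr))
    (biprod.desc (v' ≫ biprod.inl) (h ≫ biprod.inl - w ≫ biprod.inr))
    (biprod.desc (w' ≫ (biprod.inl : X' ⟶ X' ⊞ Y)⟦(1 : ℤ)⟧')
      (f⟦(1 : ℤ)⟧' ≫ (biprod.inl : X' ⟶ X' ⊞ Y)⟦(1 : ℤ)⟧' -
        u⟦(1 : ℤ)⟧' ≫ (biprod.inr : Y ⟶ X' ⊞ Y)⟦(1 : ℤ)⟧'))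

lemma mappingCone_mor₁ {X Y Z X' Y' Z' : C}
    (u : X ⟶ Y) (v : Y ⟶ Z) (w : Z ⟶ X⟦(1 : ℤ)⟧)
    (u' : X' ⟶ Y') (v' : Y' ⟶ Z') (w' : Z' ⟶ X'⟦(1 : ℤ)⟧)
    (f : X ⟶ X') (g : Y ⟶ Y') (h : Z ⟶ Z') :
    (mappingCone (Triangle.mk u v w) (Triangle.mk u' v' w') f g h).mor₁ =
      (coneTriangle u v w u' v' w' f g h).mor₁ := by
  have e : biprod.desc (biprod.lift u' 0) (biprod.lift g (-v)) =
      biprod.desc (u' ≫ biprod.inl) (g ≫ biprod.inl - v ≫ biprod.inr) := by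
    ext <;> simp
  exact e

lemma mappingCone_mor₂ {X Y Z X' Y' Z' : C}
    (u : X ⟶ Y) (v : Y ⟶ Z) (w : Z ⟶ X⟦(1 : ℤ)⟧)
    (u' : X' ⟶ Y') (v' : Y' ⟶ Z') (w' : Z' ⟶ X'⟦(1 : ℤ)⟧)
    (f : X ⟶ X') (g : Y ⟶ Y') (h : Z ⟶ Z') :
    (mappingCone (Triangle.mk u v w) (Triangle.mk u' v' w') f g h).mor₂ =
      (coneTriangle u v w u' v' w' f g h).mor₂ := by
  have e : biprod.desc (biprod.lift v' 0) (biprod.lift h (-w)) =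
      biprod.desc (v' ≫ biprod.inl) (h ≫ biprod.inl - w ≫ biprod.inr) := by
    ext <;> simp
  exact e

lemma mappingCone_mor₃ {X Y Z X' Y' Z' : C}
    (u : X ⟶ Y) (v : Y ⟶ Z) (w : Z ⟶ X⟦(1 : ℤ)⟧)
    (u' : X' ⟶ Y') (v' : Y' ⟶ Z') (w' : Z' ⟶ X'⟦(1 : ℤ)⟧)
    (f : X ⟶ X') (g : Y ⟶ Y') (h : Z ⟶ Z') :
    (mappingCone (Triangle.mk u v w) (Triangle.mk u' v' w') f g h).mor₃ =
      (coneTriangle u v w u' v' w' f g h).mor₃ := by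
  have e : biprod.desc (biprod.lift w' 0) (biprod.lift (f⟦(1 : ℤ)⟧') (-(u⟦(1 : ℤ)⟧'))) ≫
        ((shiftFunctor C (1 : ℤ)).mapBiprod X' Y).inv =
      biprod.desc (w' ≫ (biprod.inl : X' ⟶ X' ⊞ Y)⟦(1 : ℤ)⟧')
        (f⟦(1 : ℤ)⟧' ≫ (biprod.inl : X' ⟶ X' ⊞ Y)⟦(1 : ℤ)⟧' -
          u⟦(1 : ℤ)⟧' ≫ (biprod.inr : Y ⟶ X' ⊞ Y)⟦(1 : ℤ)⟧') := by
    rw [biprod.lift_eq, biprod.lift_eq]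
    apply biprod.hom_ext'
    · simp only [biprod.inl_desc_assoc, biprod.inl_desc, zero_comp, add_zero, assoc,
        inl_mapBiprod_inv]
    · simp only [biprod.inr_desc_assoc, biprod.inr_desc, Preadditive.add_comp, assoc,
        inl_mapBiprod_inv, inr_mapBiprod_inv, Preadditive.neg_comp, sub_eq_add_neg]
  exact e

lemma triangle_mk_congr {X Y Z : C} {a a' : X ⟶ Y} {b b' : Y ⟶ Z} {c c' : Z ⟶ X⟦(1 : ℤ)⟧}
    (ha : a = a') (hb : b = b') (hc : c = c') : Triangle.mk a b c = Triangle.mk a' b' c' := by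
  rw [ha, hb, hc]

lemma mappingCone_eq {X Y Z X' Y' Z' : C}
    (u : X ⟶ Y) (v : Y ⟶ Z) (w : Z ⟶ X⟦(1 : ℤ)⟧)
    (u' : X' ⟶ Y') (v' : Y' ⟶ Z') (w' : Z' ⟶ X'⟦(1 : ℤ)⟧)
    (f : X ⟶ X') (g : Y ⟶ Y') (h : Z ⟶ Z') :
    mappingCone (Triangle.mk u v w) (Triangle.mk u' v' w') f g h =
      coneTriangle u v w u' v' w' f g h := by
  have e₁ := mappingCone_mor₁ u v w u' v' w' f g h
  have e₂ := mappingCone_mor₂ u v w u' v' w' f g h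
  have e₃ := mappingCone_mor₃ u v w u' v' w' f g h
  exact triangle_mk_congr e₁ e₂ e₃

lemma isGood_of_coneTriangle_distinguished {X Y Z X' Y' Z' : C}
    {u : X ⟶ Y} {v : Y ⟶ Z} {w : Z ⟶ X⟦(1 : ℤ)⟧}
    {u' : X' ⟶ Y'} {v' : Y' ⟶ Z'} {w' : Z' ⟶ X'⟦(1 : ℤ)⟧}
    {f : X ⟶ X'} {g : Y ⟶ Y'} {h : Z ⟶ Z'}
    (H : coneTriangle u v w u' v' w' f g h ∈ distTriang C) :
    IsGood (Triangle.mk u v w) (Triangle.mk u' v' w') f g h := by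
  rw [← mappingCone_eq u v w u' v' w' f g h] at H
  exact H

lemma distinguished_of_biprod {T T₁ T₂ : Triangle C} (hT₁ : T₁ ∈ distTriang C)
    (hT₂ : T₂ ∈ distTriang C) (i₁ : T₁ ⟶ T) (i₂ : T₂ ⟶ T) (p₁ : T ⟶ T₁) (p₂ : T ⟶ T₂)
    (h₁₁ : i₁ ≫ p₁ = 𝟙 _) (h₁₂ : i₁ ≫ p₂ = 0) (h₂₁ : i₂ ≫ p₁ = 0) (h₂₂ : i₂ ≫ p₂ = 𝟙 _)
    (h : p₁ ≫ i₁ + p₂ ≫ i₂ = 𝟙 T) : T ∈ distTriang C := by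
  let S : WalkingPair → Triangle C := fun j => WalkingPair.casesOn j T₁ T₂
  have hS : productTriangle S ∈ distTriang C :=
    productTriangle_distinguished S (by rintro (_ | _) <;> assumption)
  let q : ∀ j, T ⟶ S j := fun j => WalkingPair.casesOn j p₁ p₂
  let φ : T ⟶ productTriangle S := (productTriangle.isLimitFan S).lift (Fan.mk T q)
  have hl : φ ≫ productTriangle.π S .left = p₁ :=
    (productTriangle.isLimitFan S).fac (Fan.mk T q) ⟨.left⟩
  have hr : φ ≫ productTriangle.π S .right = p₂ :=
    (productTriangle.isLimitFan S).fac (Fan.mk T q) ⟨.right⟩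
  let ψ : productTriangle S ⟶ T :=
    productTriangle.π S .left ≫ i₁ + productTriangle.π S .right ≫ i₂
  refine isomorphic_distinguished _ hS _ ⟨φ, ψ, ?_, ?_⟩
  · simp only [ψ, Preadditive.comp_add, reassoc_of% hl, reassoc_of% hr, h]
  · refine (productTriangle.isLimitFan S).hom_ext ?_
    rintro ⟨_ | _⟩
    · change (_ ≫ _) ≫ productTriangle.π S .left = _ ≫ productTriangle.π S .left
      simp only [ψ, assoc, hl, Preadditive.add_comp, h₁₁, h₂₁, comp_zero, add_zero]
      exact (comp_id _).trans (id_comp _).symm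
    · change (_ ≫ _) ≫ productTriangle.π S .right = _ ≫ productTriangle.π S .right
      simp only [ψ, assoc, hr, Preadditive.add_comp, h₁₂, h₂₂, comp_zero, zero_add]
      exact (comp_id _).trans (id_comp _).symm

lemma mk_distinguished_of_biprod {X Y Z X₁ Y₁ Z₁ X₂ Y₂ Z₂ : C}
    {a : X ⟶ Y} {b : Y ⟶ Z} {c : Z ⟶ X⟦(1 : ℤ)⟧}
    {a₁ : X₁ ⟶ Y₁} {b₁ : Y₁ ⟶ Z₁} {c₁ : Z₁ ⟶ X₁⟦(1 : ℤ)⟧}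
    {a₂ : X₂ ⟶ Y₂} {b₂ : Y₂ ⟶ Z₂} {c₂ : Z₂ ⟶ X₂⟦(1 : ℤ)⟧}
    (h₁ : Triangle.mk a₁ b₁ c₁ ∈ distTriang C) (h₂ : Triangle.mk a₂ b₂ c₂ ∈ distTriang C)
    (iX₁ : X₁ ⟶ X) (iY₁ : Y₁ ⟶ Y) (iZ₁ : Z₁ ⟶ Z)
    (iX₂ : X₂ ⟶ X) (iY₂ : Y₂ ⟶ Y) (iZ₂ : Z₂ ⟶ Z)
    (pX₁ : X ⟶ X₁) (pY₁ : Y ⟶ Y₁) (pZ₁ : Z ⟶ Z₁)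
    (pX₂ : X ⟶ X₂) (pY₂ : Y ⟶ Y₂) (pZ₂ : Z ⟶ Z₂)
    (hi₁ : a₁ ≫ iY₁ = iX₁ ≫ a ∧ b₁ ≫ iZ₁ = iY₁ ≫ b ∧ c₁ ≫ iX₁⟦(1 : ℤ)⟧' = iZ₁ ≫ c)
    (hi₂ : a₂ ≫ iY₂ = iX₂ ≫ a ∧ b₂ ≫ iZ₂ = iY₂ ≫ b ∧ c₂ ≫ iX₂⟦(1 : ℤ)⟧' = iZ₂ ≫ c)
    (hp₁ : a ≫ pY₁ = pX₁ ≫ a₁ ∧ b ≫ pZ₁ = pY₁ ≫ b₁ ∧ c ≫ pX₁⟦(1 : ℤ)⟧' = pZ₁ ≫ c₁)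
    (hp₂ : a ≫ pY₂ = pX₂ ≫ a₂ ∧ b ≫ pZ₂ = pY₂ ≫ b₂ ∧ c ≫ pX₂⟦(1 : ℤ)⟧' = pZ₂ ≫ c₂)
    (h₁₁ : iX₁ ≫ pX₁ = 𝟙 _ ∧ iY₁ ≫ pY₁ = 𝟙 _ ∧ iZ₁ ≫ pZ₁ = 𝟙 _)
    (h₁₂ : iX₁ ≫ pX₂ = 0 ∧ iY₁ ≫ pY₂ = 0 ∧ iZ₁ ≫ pZ₂ = 0)
    (h₂₁ : iX₂ ≫ pX₁ = 0 ∧ iY₂ ≫ pY₁ = 0 ∧ iZ₂ ≫ pZ₁ = 0)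
    (h₂₂ : iX₂ ≫ pX₂ = 𝟙 _ ∧ iY₂ ≫ pY₂ = 𝟙 _ ∧ iZ₂ ≫ pZ₂ = 𝟙 _)
    (h : pX₁ ≫ iX₁ + pX₂ ≫ iX₂ = 𝟙 _ ∧ pY₁ ≫ iY₁ + pY₂ ≫ iY₂ = 𝟙 _ ∧
      pZ₁ ≫ iZ₁ + pZ₂ ≫ iZ₂ = 𝟙 _) :
    Triangle.mk a b c ∈ distTriang C :=
  distinguished_of_biprod h₁ h₂
    (Triangle.homMk (Triangle.mk a₁ b₁ c₁) (Triangle.mk a b c) iX₁ iY₁ iZ₁ hi₁.1 hi₁.2.1 hi₁.2.2)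
    (Triangle.homMk (Triangle.mk a₂ b₂ c₂) (Triangle.mk a b c) iX₂ iY₂ iZ₂ hi₂.1 hi₂.2.1 hi₂.2.2)
    (Triangle.homMk (Triangle.mk a b c) (Triangle.mk a₁ b₁ c₁) pX₁ pY₁ pZ₁ hp₁.1 hp₁.2.1 hp₁.2.2)
    (Triangle.homMk (Triangle.mk a b c) (Triangle.mk a₂ b₂ c₂) pX₂ pY₂ pZ₂ hp₂.1 hp₂.2.1 hp₂.2.2)
    (Triangle.hom_ext _ _ h₁₁.1 h₁₁.2.1 h₁₁.2.2) (Triangle.hom_ext _ _ h₁₂.1 h₁₂.2.1 h₁₂.2.2)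
    (Triangle.hom_ext _ _ h₂₁.1 h₂₁.2.1 h₂₁.2.2) (Triangle.hom_ext _ _ h₂₂.1 h₂₂.2.1 h₂₂.2.2)
    (Triangle.hom_ext _ _ h.1 h.2.1 h.2.2)

lemma coneTriangle_id_distinguished {X Y Z : C} (u : X ⟶ Y) (v : Y ⟶ Z) (w : Z ⟶ X⟦(1 : ℤ)⟧)
    (huv : u ≫ v = 0) (hvw : v ≫ w = 0) (hwu : w ≫ u⟦(1 : ℤ)⟧' = 0) :
    coneTriangle u v w u v w (𝟙 X) (𝟙 Y) (𝟙 Z) ∈ distTriang C := by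
  refine mk_distinguished_of_biprod (binaryBiproductTriangle_distinguished Y Z)
    (contractible_distinguished₂ X)
    biprod.inr (biprod.desc (biprod.inl - v ≫ biprod.inr) biprod.inr)
    (biprod.inl - w ≫ biprod.inr)
    (biprod.inl - u ≫ biprod.inr) 0 biprod.inr
    (biprod.fst ≫ u + biprod.snd) (biprod.desc (biprod.inl + v ≫ biprod.inr) biprod.inr) biprod.fst
    biprod.fst 0 (biprod.desc w (𝟙 _))
    ?_ ?_ ?_ ?_ ?_ ?_ ?_ ?_ ?_
  all_goals refine ⟨?_, ?_, ?_⟩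
  all_goals try apply biprod.hom_ext'
  all_goals simp [hvw, hwu, reassoc_of% huv, reassoc_of% hvw, reassoc_of% hwu,
    shift_inl_fst, shift_inl_snd, shift_inr_fst, shift_inr_snd, shift_inl_fst_assoc, shift_inr_fst_assoc]

lemma neg_rotate_distinguished {X Y Z : C} {u : X ⟶ Y} {v : Y ⟶ Z} {w : Z ⟶ X⟦(1 : ℤ)⟧}
    (hT : Triangle.mk u v w ∈ distTriang C) :
    Triangle.mk (-v) (-w) (-(u⟦(1 : ℤ)⟧')) ∈ distTriang C := by
  let e : Z ≅ Z := ⟨-𝟙 Z, -𝟙 Z, by simp, by simp⟩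
  exact isomorphic_distinguished _ (rot_of_distTriang _ hT) _
    (Triangle.isoMk (Triangle.mk (-v) (-w) (-(u⟦(1 : ℤ)⟧'))) (Triangle.mk v w (-(u⟦(1 : ℤ)⟧')))
      (Iso.refl _) e (Iso.refl _)
      (by change (-v) ≫ (-𝟙 Z) = 𝟙 Y ≫ v; simp)
      (by change (-w) ≫ 𝟙 _ = (-𝟙 Z) ≫ w; simp)
      (by change (-(u⟦(1 : ℤ)⟧')) ≫ (𝟙 Y)⟦(1 : ℤ)⟧' = 𝟙 _ ≫ (-(u⟦(1 : ℤ)⟧')); simp))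

section

variable {X Y Z X' Y' Z' : C}
  {u : X ⟶ Y} {v : Y ⟶ Z} {w : Z ⟶ X⟦(1 : ℤ)⟧}
  {u' : X' ⟶ Y'} {v' : Y' ⟶ Z'} {w' : Z' ⟶ X'⟦(1 : ℤ)⟧}
  {f : X ⟶ X'} {g : Y ⟶ Y'} {h : Z ⟶ Z'}

lemma coneTriangle_inl_distinguished
    (hT : Triangle.mk u v w ∈ distTriang C) (hT' : Triangle.mk u' v' w' ∈ distTriang C)
    (hug : u ≫ g = f ≫ u') (hvh : v ≫ h = g ≫ v')
    (hwf : w ≫ f⟦(1 : ℤ)⟧' = h ≫ w') :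
    coneTriangle u' v' w'
      (biprod.desc (u' ≫ biprod.inl) (g ≫ biprod.inl - v ≫ biprod.inr))
      (biprod.desc (v' ≫ biprod.inl) (h ≫ biprod.inl - w ≫ biprod.inr))
      (biprod.desc (w' ≫ (biprod.inl : X' ⟶ X' ⊞ Y)⟦(1 : ℤ)⟧')
        (f⟦(1 : ℤ)⟧' ≫ (biprod.inl : X' ⟶ X' ⊞ Y)⟦(1 : ℤ)⟧' -
          u⟦(1 : ℤ)⟧' ≫ (biprod.inr : Y ⟶ X' ⊞ Y)⟦(1 : ℤ)⟧'))
      biprod.inl biprod.inl biprod.inl ∈ distTriang C := by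
  have hug' : u⟦(1 : ℤ)⟧' ≫ g⟦(1 : ℤ)⟧' = f⟦(1 : ℤ)⟧' ≫ u'⟦(1 : ℤ)⟧' := by
    rw [← Functor.map_comp, hug, Functor.map_comp]
  have hug'_assoc := reassoc_of% hug'
  have hvh_assoc := reassoc_of% hvh
  have hwf_assoc := reassoc_of% hwf
  refine mk_distinguished_of_biprod
    (coneTriangle_id_distinguished u' v' w' (comp_distTriang_mor_zero₁₂ _ hT')
      (comp_distTriang_mor_zero₂₃ _ hT') (comp_distTriang_mor_zero₃₁ _ hT'))
    (neg_rotate_distinguished hT)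
    (biprod.fst ≫ biprod.inl ≫ biprod.inl + biprod.snd ≫ biprod.inr)
    (biprod.fst ≫ biprod.inl ≫ biprod.inl + biprod.snd ≫ biprod.inr)
    (biprod.fst ≫ biprod.inl ≫ biprod.inl + biprod.snd ≫ biprod.inr)
    (biprod.inr ≫ biprod.inl - g ≫ biprod.inr) (biprod.inr ≫ biprod.inl - h ≫ biprod.inr)
    (biprod.inr ≫ biprod.inl - f⟦(1 : ℤ)⟧' ≫ biprod.inr)
    (biprod.fst ≫ biprod.fst ≫ biprod.inl + biprod.fst ≫ biprod.snd ≫ g ≫ biprod.inr +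
      biprod.snd ≫ biprod.inr)
    (biprod.fst ≫ biprod.fst ≫ biprod.inl + biprod.fst ≫ biprod.snd ≫ h ≫ biprod.inr +
      biprod.snd ≫ biprod.inr)
    (biprod.fst ≫ biprod.fst ≫ biprod.inl + biprod.fst ≫ biprod.snd ≫ f⟦(1 : ℤ)⟧' ≫ biprod.inr +
      biprod.snd ≫ biprod.inr)
    (biprod.fst ≫ biprod.snd) (biprod.fst ≫ biprod.snd) (biprod.fst ≫ biprod.snd)
    ?_ ?_ ?_ ?_ ?_ ?_ ?_ ?_ ?_
  all_goals refine ⟨?_, ?_, ?_⟩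
  all_goals try apply biprod.hom_ext'
  all_goals try apply biprod.hom_ext'
  all_goals simp only [assoc, Functor.map_comp, Functor.map_add, Functor.map_sub,
    CategoryTheory.Functor.map_id, comp_id, id_comp, comp_zero, zero_comp, add_zero, zero_add,
    sub_zero, zero_sub,
    Preadditive.comp_add, Preadditive.add_comp, Preadditive.comp_sub, Preadditive.sub_comp,
    Preadditive.comp_neg, Preadditive.neg_comp,
    biprod.inl_desc, biprod.inr_desc, biprod.inl_desc_assoc, biprod.inr_desc_assoc,
    biprod.inl_snd, biprod.inr_snd,
    biprod.inl_fst_assoc, biprod.inl_snd_assoc, biprod.inr_fst_assoc, biprod.inr_snd_assoc,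
    hug'_assoc, hvh_assoc, hwf_assoc,
    shift_inl_snd, shift_inr_snd, shift_inl_fst_assoc,
    shift_inl_snd_assoc, shift_inr_fst_assoc, shift_inr_snd_assoc]
  all_goals try abel

lemma coneTriangle_snd_distinguished
    (hT : Triangle.mk u v w ∈ distTriang C) (hT' : Triangle.mk u' v' w' ∈ distTriang C)
    (hug : u ≫ g = f ≫ u') (hvh : v ≫ h = g ≫ v')
    (hwf : w ≫ f⟦(1 : ℤ)⟧' = h ≫ w') :
    coneTriangle
      (biprod.desc (u' ≫ biprod.inl) (g ≫ biprod.inl - v ≫ biprod.inr))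
      (biprod.desc (v' ≫ biprod.inl) (h ≫ biprod.inl - w ≫ biprod.inr))
      (biprod.desc (w' ≫ (biprod.inl : X' ⟶ X' ⊞ Y)⟦(1 : ℤ)⟧')
        (f⟦(1 : ℤ)⟧' ≫ (biprod.inl : X' ⟶ X' ⊞ Y)⟦(1 : ℤ)⟧' -
          u⟦(1 : ℤ)⟧' ≫ (biprod.inr : Y ⟶ X' ⊞ Y)⟦(1 : ℤ)⟧'))
      (-v) (-w) (-(u⟦(1 : ℤ)⟧'))
      biprod.snd biprod.snd biprod.snd ∈ distTriang C := by
  have hug' : u⟦(1 : ℤ)⟧' ≫ g⟦(1 : ℤ)⟧' = f⟦(1 : ℤ)⟧' ≫ u'⟦(1 : ℤ)⟧' := by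
    rw [← Functor.map_comp, hug, Functor.map_comp]
  have hug'_assoc := reassoc_of% hug'
  have hvh_assoc := reassoc_of% hvh
  have hwf_assoc := reassoc_of% hwf
  have hR := neg_rotate_distinguished hT
  refine mk_distinguished_of_biprod
    (coneTriangle_id_distinguished (-v) (-w) (-(u⟦(1 : ℤ)⟧')) (comp_distTriang_mor_zero₁₂ _ hR)
      (comp_distTriang_mor_zero₂₃ _ hR) (comp_distTriang_mor_zero₃₁ _ hR))
    (neg_rotate_distinguished hT')
    (biprod.fst ≫ biprod.inl - biprod.fst ≫ g ≫ biprod.inl ≫ biprod.inr +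
      biprod.snd ≫ biprod.inr ≫ biprod.inr)
    (biprod.desc (biprod.inl - h ≫ biprod.inl ≫ biprod.inr) (biprod.inr ≫ biprod.inr))
    (biprod.desc (biprod.inl - f⟦(1 : ℤ)⟧' ≫ (biprod.inl : X' ⟶ X' ⊞ Y)⟦(1 : ℤ)⟧' ≫ biprod.inr)
      ((biprod.inr : Y ⟶ X' ⊞ Y)⟦(1 : ℤ)⟧' ≫ biprod.inr))
    (biprod.inl ≫ biprod.inr) (biprod.inl ≫ biprod.inr)
    ((biprod.inl : X' ⟶ X' ⊞ Y)⟦(1 : ℤ)⟧' ≫ biprod.inr)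
    (biprod.fst ≫ biprod.inl + biprod.snd ≫ biprod.snd ≫ biprod.inr)
    (biprod.fst ≫ biprod.inl + biprod.snd ≫ biprod.snd ≫ biprod.inr)
    (biprod.fst ≫ biprod.inl + biprod.snd ≫ (biprod.snd : X' ⊞ Y ⟶ Y)⟦(1 : ℤ)⟧' ≫ biprod.inr)
    (biprod.fst ≫ g + biprod.snd ≫ biprod.fst) (biprod.fst ≫ h + biprod.snd ≫ biprod.fst)
    (biprod.fst ≫ f⟦(1 : ℤ)⟧' + biprod.snd ≫ (biprod.fst : X' ⊞ Y ⟶ X')⟦(1 : ℤ)⟧')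
    ?_ ?_ ?_ ?_ ?_ ?_ ?_ ?_ ?_
  all_goals refine ⟨?_, ?_, ?_⟩
  all_goals try apply biprod.hom_ext'
  all_goals try apply biprod.hom_ext'
  all_goals try apply shift_biprod_hom_ext
  all_goals simp only [assoc, Functor.map_comp, Functor.map_add, Functor.map_sub, Functor.map_neg,
    CategoryTheory.Functor.map_id, comp_id, id_comp, comp_zero, zero_comp, add_zero, zero_add,
    sub_zero, zero_sub,
    Preadditive.comp_add, Preadditive.add_comp, Preadditive.comp_sub, Preadditive.sub_comp,
    Preadditive.comp_neg, Preadditive.neg_comp,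
    biprod.inl_desc, biprod.inr_desc, biprod.inl_desc_assoc, biprod.inr_desc_assoc,
    biprod.inl_fst, biprod.inr_fst,
    biprod.inl_fst_assoc, biprod.inl_snd_assoc, biprod.inr_fst_assoc, biprod.inr_snd_assoc,
    hug', hvh, hwf, hug'_assoc, hvh_assoc, hwf_assoc,
    shift_inl_desc_assoc, shift_inr_desc_assoc,
    shift_inl_fst, shift_inr_fst, shift_inl_fst_assoc,
    shift_inl_snd_assoc, shift_inr_fst_assoc, shift_inr_snd_assoc]
  all_goals try abel

variable {a : X' ⊞ Y ⟶ Y' ⊞ Z} {b : Y' ⊞ Z ⟶ Z' ⊞ X⟦(1 : ℤ)⟧}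
  {c : Z' ⊞ X⟦(1 : ℤ)⟧ ⟶ (X' ⊞ Y)⟦(1 : ℤ)⟧}

lemma isTriMap_inl (ha : a = (coneTriangle u v w u' v' w' f g h).mor₁)
    (hb : b = (coneTriangle u v w u' v' w' f g h).mor₂)
    (hc : c = (coneTriangle u v w u' v' w' f g h).mor₃) :
    IsTriMap (Triangle.mk u' v' w') (Triangle.mk a b c) biprod.inl biprod.inl biprod.inl := by
  subst ha hb hc
  exact ⟨(biprod.inl_desc _ _).symm, (biprod.inl_desc _ _).symm, (biprod.inl_desc _ _).symm⟩

lemma isTriMap_snd (ha : a = (coneTriangle u v w u' v' w' f g h).mor₁)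
    (hb : b = (coneTriangle u v w u' v' w' f g h).mor₂)
    (hc : c = (coneTriangle u v w u' v' w' f g h).mor₃) :
    IsTriMap (Triangle.mk a b c) (Triangle.mk (-v) (-w) (-(u⟦(1 : ℤ)⟧')))
      biprod.snd biprod.snd biprod.snd := by
  have h₁ : a ≫ biprod.snd = biprod.snd ≫ (-v) := by
    subst ha; apply biprod.hom_ext' <;> simp
  have h₂ : b ≫ biprod.snd = biprod.snd ≫ (-w) := by
    subst hb; apply biprod.hom_ext' <;> simp
  have h₃ : c ≫ (biprod.snd : X' ⊞ Y ⟶ Y)⟦(1 : ℤ)⟧' = biprod.snd ≫ (-(u⟦(1 : ℤ)⟧')) := by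
    subst hc; apply biprod.hom_ext' <;> simp [shift_inl_snd, shift_inr_snd]
  exact ⟨h₁, h₂, h₃⟩

lemma isGood_inl (hT : Triangle.mk u v w ∈ distTriang C)
    (hT' : Triangle.mk u' v' w' ∈ distTriang C)
    (hmap : IsTriMap (Triangle.mk u v w) (Triangle.mk u' v' w') f g h)
    (ha : a = (coneTriangle u v w u' v' w' f g h).mor₁)
    (hb : b = (coneTriangle u v w u' v' w' f g h).mor₂)
    (hc : c = (coneTriangle u v w u' v' w' f g h).mor₃) :
    IsGood (Triangle.mk u' v' w') (Triangle.mk a b c) biprod.inl biprod.inl biprod.inl := by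
  subst ha hb hc
  exact isGood_of_coneTriangle_distinguished
    (coneTriangle_inl_distinguished hT hT' hmap.1 hmap.2.1 hmap.2.2)

lemma isGood_snd (hT : Triangle.mk u v w ∈ distTriang C)
    (hT' : Triangle.mk u' v' w' ∈ distTriang C)
    (hmap : IsTriMap (Triangle.mk u v w) (Triangle.mk u' v' w') f g h)
    (ha : a = (coneTriangle u v w u' v' w' f g h).mor₁)
    (hb : b = (coneTriangle u v w u' v' w' f g h).mor₂)
    (hc : c = (coneTriangle u v w u' v' w' f g h).mor₃) :
    IsGood (Triangle.mk a b c) (Triangle.mk (-v) (-w) (-(u⟦(1 : ℤ)⟧')))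
      biprod.snd biprod.snd biprod.snd := by
  subst ha hb hc
  exact isGood_of_coneTriangle_distinguished
    (coneTriangle_snd_distinguished hT hT' hmap.1 hmap.2.1 hmap.2.2)

end

theorem stmt_6 {X Y Z X' Y' Z' : C}
    (u : X ⟶ Y) (v : Y ⟶ Z) (w : Z ⟶ X⟦(1 : ℤ)⟧)
    (u' : X' ⟶ Y') (v' : Y' ⟶ Z') (w' : Z' ⟶ X'⟦(1 : ℤ)⟧)
    (hT : Triangle.mk u v w ∈ distTriang C)
    (hT' : Triangle.mk u' v' w' ∈ distTriang C)
    (f : X ⟶ X') (g : Y ⟶ Y') (h : Z ⟶ Z')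
    (hmap : IsTriMap (Triangle.mk u v w) (Triangle.mk u' v' w') f g h)
    (hgood : IsGood (Triangle.mk u v w) (Triangle.mk u' v' w') f g h) :
    (IsTriMap (Triangle.mk u' v' w') (mappingCone (Triangle.mk u v w) (Triangle.mk u' v' w') f g h) biprod.inl biprod.inl biprod.inl ∧
      IsGood (Triangle.mk u' v' w') (mappingCone (Triangle.mk u v w) (Triangle.mk u' v' w') f g h) biprod.inl biprod.inl biprod.inl) ∧
    (IsTriMap (mappingCone (Triangle.mk u v w) (Triangle.mk u' v' w') f g h) (Triangle.mk (-v) (-w) (-(u⟦(1 : ℤ)⟧'))) biprod.snd biprod.snd biprod.snd ∧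
      IsGood (mappingCone (Triangle.mk u v w) (Triangle.mk u' v' w') f g h) (Triangle.mk (-v) (-w) (-(u⟦(1 : ℤ)⟧'))) biprod.snd biprod.snd biprod.snd) := by
  have ha := mappingCone_mor₁ u v w u' v' w' f g h
  have hb := mappingCone_mor₂ u v w u' v' w' f g h
  have hc := mappingCone_mor₃ u v w u' v' w' f g h
  exact ⟨⟨isTriMap_inl ha hb hc, isGood_inl hT hT' hmap ha hb hc⟩,
    ⟨isTriMap_snd ha hb hc, isGood_snd hT hT' hmap ha hb hc⟩⟩
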